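/- Let A be a singular N×N complex matrix of rank n, F(X) := X − (A·X)^{*3}, B an n×N matrix with ker B = ker A, C an N×n matrix with B·C = I_n, and f(x) := B·F(C·x). Let λ ∈ ℂ, λ ≠ 0, |λ| ≠ 1, let K_λ : ℂ^N → ℂ^N be a global pre-conjugation of F, and set k_λ(x) := B·K_λ(C·x), so that k_λ is a global pre-conjugation of f. If k_λ is injective, then K_λ is injective; if k_λ is surjective, then K_λ is surjective; and if k_λ is bijective, then K_λ is bijective with K_λ⁻¹(Y) = Y − K_λ(C·k_λ⁻¹(B·Y)) + C·k_λ⁻¹(B·Y) for all Y ∈ ℂ^N. -/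

import Mathlib

open Matrix

noncomputable section

/-- Componentwise (Hadamard) cube of a vector: `x^{*3}`. -/
def cube3 {m : ℕ} (v : Fin m → ℂ) : Fin m → ℂ := fun i => (v i) ^ 3

/-- An analytic curve `d` with vanishing 1-jet at `0` satisfying
`d (μ t) = μ (d t - m t * A d t)` with `m t → 0` vanishes identically, provided `‖μ‖ ≠ 1`. -/
lemma eq_zero_of_perturbed_dilation {N : ℕ} {μ : ℂ} (hμ0 : μ ≠ 0) (hμ1 : ‖μ‖ ≠ 1)
    (A : Matrix (Fin N) (Fin N) ℂ) {d m : ℂ → Fin N → ℂ}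
    (hd : AnalyticOnNhd ℂ d Set.univ) (hd0 : d 0 = 0) (hd' : HasDerivAt d 0 0)
    (hm : ContinuousAt m 0) (hm0 : m 0 = 0)
    (h : ∀ t, d (μ * t) = μ • (d t - m t * A.mulVec (d t))) (t : ℂ) : d t = 0 := by
  by_cases hz : ∀ᶠ z in nhds (0 : ℂ), d z = 0
  · exact hd.eqOn_zero_of_preconnected_of_eventuallyEq_zero isPreconnected_univ
      (Set.mem_univ 0) hz (Set.mem_univ t)
  exfalso
  obtain ⟨p, g, hg, hg0, hdg⟩ :=
    (hd 0 (Set.mem_univ 0)).exists_eventuallyEq_pow_smul_nonzero_iff.mpr hz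
  simp only [sub_zero] at hdg
  have hp : 2 ≤ p := by
    by_contra! hlt
    interval_cases p
    · apply hg0
      simpa [hd0] using hdg.self_of_nhds.symm
    · apply hg0
      have h1 : HasDerivAt (fun z : ℂ => z ^ 1 • g z) (g 0) 0 := by
        simpa [Pi.smul_def'] using (hasDerivAt_id (0 : ℂ)).smul hg.differentiableAt.hasDerivAt
      exact (h1.congr_of_eventuallyEq hdg).unique hd'
  have hscale : Filter.Tendsto (fun z : ℂ => μ * z) (nhds 0) (nhds 0) := by
    simpa using (continuous_const_mul μ).tendsto 0
  have hrel : ∀ᶠ z in nhdsWithin (0 : ℂ) {0}ᶜ,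
      μ ^ p • g (μ * z) = μ • (g z - m z * A.mulVec (g z)) := by
    filter_upwards [hdg.filter_mono nhdsWithin_le_nhds,
      (hscale.eventually hdg).filter_mono nhdsWithin_le_nhds, self_mem_nhdsWithin]
      with z hz1 hz2 hz0
    have hzp : z ^ p ≠ 0 := pow_ne_zero p hz0
    have key := h z
    rw [hz1, hz2, mulVec_smul, mul_smul_comm, ← smul_sub, smul_comm μ, mul_pow,
      mul_comm, mul_smul] at key
    exact smul_right_injective _ hzp key
  have hgc := hg.continuousAt
  have hlim1 : Filter.Tendsto (fun z => μ ^ p • g (μ * z)) (nhdsWithin 0 {0}ᶜ)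
      (nhds (μ ^ p • g 0)) :=
    ((hgc.tendsto.comp hscale).const_smul _).mono_left nhdsWithin_le_nhds
  have hlim2 : Filter.Tendsto (fun z => μ • (g z - m z * A.mulVec (g z)))
      (nhdsWithin 0 {0}ᶜ) (nhds (μ • g 0)) := by
    have hA : ContinuousAt (fun z => A.mulVec (g z)) 0 :=
      (Continuous.matrix_mulVec continuous_const continuous_id).continuousAt.comp hgc
    have hlim : ContinuousAt (fun z => μ • (g z - m z * A.mulVec (g z))) 0 :=
      (hgc.sub (hm.mul hA)).const_smul μ
    simpa [hm0] using hlim.tendsto.mono_left nhdsWithin_le_nhds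
  have heq : μ ^ p • g 0 = μ • g 0 :=
    tendsto_nhds_unique (hlim1.congr' hrel) hlim2
  have hpow : μ ^ p = μ := smul_left_injective ℂ hg0 heq
  obtain ⟨q, rfl⟩ : ∃ q, p = q + 1 := ⟨p - 1, by omega⟩
  have hq : μ ^ q = 1 := mul_right_cancel₀ hμ0 (by rw [← pow_succ, hpow, one_mul])
  exact hμ1 (Complex.norm_eq_one_of_pow_eq_one hq (by omega))

/-- A global pre-conjugation of a cubic-linear map commutes with translations along `ker A`. -/
lemma preconjugation_add_of_mulVec_eq_zero {N : ℕ} {A : Matrix (Fin N) (Fin N) ℂ}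
    {μ : ℂ} (hμ0 : μ ≠ 0) (hμ1 : ‖μ‖ ≠ 1) {K : (Fin N → ℂ) → (Fin N → ℂ)}
    (hKan : AnalyticOnNhd ℂ K Set.univ) (hK0 : K 0 = 0)
    (hK'0 : fderiv ℂ K 0 = ContinuousLinearMap.id ℂ (Fin N → ℂ))
    (hKconj : ∀ X, μ • (K X - cube3 (A.mulVec (K X))) = K (μ • X))
    (X : Fin N → ℂ) {Z : Fin N → ℂ} (hZ : A.mulVec Z = 0) : K (X + Z) = K X + Z := by
  have hcurve (W : Fin N → ℂ) : AnalyticOnNhd ℂ (fun t : ℂ => K (t • W)) Set.univ :=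
    fun t _ => (hKan (t • W) (Set.mem_univ _)).comp_of_eq (by fun_prop) rfl
  have hderiv (W : Fin N → ℂ) : HasDerivAt (fun t : ℂ => K (t • W)) W 0 := by
    have h1 : HasFDerivAt K (ContinuousLinearMap.id ℂ (Fin N → ℂ)) ((0 : ℂ) • W) := by
      rw [zero_smul, ← hK'0]
      exact (hKan 0 (Set.mem_univ 0)).differentiableAt.hasFDerivAt
    have h2 : HasDerivAt (fun t : ℂ => t • W) W 0 := by
      simpa using (hasDerivAt_id (0 : ℂ)).smul_const W
    simpa [Function.comp_def] using h1.comp_hasDerivAt (0 : ℂ) h2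
  let a : ℂ → Fin N → ℂ := fun t => A.mulVec (K (t • X))
  let b : ℂ → Fin N → ℂ := fun t => A.mulVec (K (t • (X + Z)))
  have hcont (W : Fin N → ℂ) : ContinuousAt (fun t : ℂ => A.mulVec (K (t • W))) 0 :=
    (Continuous.matrix_mulVec continuous_const continuous_id).continuousAt.comp
      (hcurve W 0 (Set.mem_univ 0)).continuousAt
  have ha : ContinuousAt a 0 := hcont X
  have hb : ContinuousAt b 0 := hcont (X + Z)
  have key := eq_zero_of_perturbed_dilation hμ0 hμ1 A
    (d := fun t => K (t • (X + Z)) - t • Z - K (t • X))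
    (m := fun t => a t * a t + a t * b t + b t * b t)
    (fun t ht => ((hcurve (X + Z) t ht).sub (by fun_prop)).sub (hcurve X t ht))
    (by simp [hK0])
    (by
      have hlin : HasDerivAt (fun t : ℂ => t • Z) Z 0 := by
        simpa using (hasDerivAt_id (0 : ℂ)).smul_const Z
      simpa [Pi.sub_def] using ((hderiv (X + Z)).sub hlin).sub (hderiv X))
    (((ha.mul ha).add (ha.mul hb)).add (hb.mul hb))
    (by simp [a, b, hK0])
    (fun t => by
      have hdiff : A.mulVec (K (t • (X + Z)) - t • Z - K (t • X)) = b t - a t := by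
        simp [a, b, mulVec_sub, mulVec_smul, hZ]
      simp only [hdiff, mul_smul, ← hKconj]
      ext i
      simp only [Pi.sub_apply, Pi.smul_apply, Pi.mul_apply, Pi.add_apply, smul_eq_mul, cube3,
        a, b]
      ring) 1
  simp only [one_smul] at key
  rw [sub_sub, sub_eq_zero] at key
  rw [key, add_comm]

/-- If the induced pre-conjugation `k_λ(x) := B·K_λ(C·x)` of the paired map `f`
is injective (resp. surjective, bijective), then so is the global
pre-conjugation `K_λ` of the cubic-linear map `F`; when `k_λ` is bijective,
`K_λ⁻¹(Y) = Y − K_λ(C·k_λ⁻¹(B·Y)) + C·k_λ⁻¹(B·Y)`. -/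
theorem preconjugation_invertibility_ascends (N n : ℕ) (hn : n < N)
    (A : Matrix (Fin N) (Fin N) ℂ) (hrank : A.rank = n)
    (F : (Fin N → ℂ) → (Fin N → ℂ))
    (hF : ∀ X, F X = X - cube3 (A.mulVec X))
    (B : Matrix (Fin n) (Fin N) ℂ)
    (hker : LinearMap.ker B.mulVecLin = LinearMap.ker A.mulVecLin)
    (C : Matrix (Fin N) (Fin n) ℂ) (hC : B * C = 1)
    (f : (Fin n → ℂ) → (Fin n → ℂ))
    (hf : ∀ x, f x = B.mulVec (F (C.mulVec x)))
    (lam : ℂ) (hlam0 : lam ≠ 0) (hlam1 : ‖lam‖ ≠ 1)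
    (K : (Fin N → ℂ) → (Fin N → ℂ))
    (hKan : AnalyticOnNhd ℂ K Set.univ)
    (hK0 : K 0 = 0)
    (hK'0 : fderiv ℂ K 0 = ContinuousLinearMap.id ℂ (Fin N → ℂ))
    (hKconj : ∀ X : Fin N → ℂ, lam • F (K X) = K (lam • X))
    (k : (Fin n → ℂ) → (Fin n → ℂ))
    (hk : ∀ x, k x = B.mulVec (K (C.mulVec x))) :
    (Function.Injective k → Function.Injective K) ∧
    (Function.Surjective k → Function.Surjective K) ∧
    (Function.Bijective k → Function.Bijective K ∧
      ∀ Y : Fin N → ℂ,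
        Function.invFun K Y =
          Y - K (C.mulVec (Function.invFun k (B.mulVec Y)))
            + C.mulVec (Function.invFun k (B.mulVec Y))) := by
  have hBC (x : Fin n → ℂ) : B.mulVec (C.mulVec x) = x := by
    rw [mulVec_mulVec, hC, one_mulVec]
  have hfiber (X : Fin N → ℂ) (x : Fin n → ℂ) (hx : B.mulVec X = x) :
      K X = K (C.mulVec x) + (X - C.mulVec x) := by
    have hmem : X - C.mulVec x ∈ LinearMap.ker B.mulVecLin := by
      simp [mulVec_sub, hBC, hx]
    rw [hker] at hmem
    have := preconjugation_add_of_mulVec_eq_zero hlam0 hlam1 hKan hK0 hK'0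
      (fun X => by rw [← hKconj, hF]) (C.mulVec x) (Z := X - C.mulVec x)
      (by simpa using hmem)
    rwa [add_sub_cancel] at this
  have hsemi (X : Fin N → ℂ) : k (B.mulVec X) = B.mulVec (K X) := by
    rw [hfiber X _ rfl, hk, mulVec_add, mulVec_sub, hBC, sub_self, add_zero]
  have hpre (Y : Fin N → ℂ) (x : Fin n → ℂ) (hx : k x = B.mulVec Y) :
      K (Y - K (C.mulVec x) + C.mulVec x) = Y := by
    rw [hfiber _ x (by rw [mulVec_add, mulVec_sub, hBC, ← hk, hx, sub_self, zero_add])]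
    abel
  have hinj (h : Function.Injective k) : Function.Injective K := by
    intro X Y hXY
    have hB : B.mulVec X = B.mulVec Y := h (by rw [hsemi, hsemi, hXY])
    rw [hfiber X _ rfl, hfiber Y _ rfl, hB] at hXY
    exact sub_left_injective (add_right_injective _ hXY)
  have hsurj (h : Function.Surjective k) : Function.Surjective K := fun Y =>
    let ⟨x, hx⟩ := h (B.mulVec Y)
    ⟨_, hpre Y x hx⟩
  refine ⟨hinj, hsurj, fun h => ⟨⟨hinj h.1, hsurj h.2⟩, fun Y => hinj h.1 ?_⟩⟩
  rw [Function.rightInverse_invFun (hsurj h.2) Y,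
    hpre Y _ (Function.rightInverse_invFun h.2 (B.mulVec Y))]
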